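/- arXiv:1508.02643 — 2 statements merged into one kernel-verified Lean document; each statement's English description precedes it below -/
import Mathlib

section
/- Let N be a positive integer, let D be an N×N Hermitian positive-definite complex matrix with ‖D − I‖_op ≤ 1/4, and let ε be a real number with |ε| ≤ N/9. Then there exists δ ∈ ℝ with |δ| ≤ 4|ε|/N such that D + δ·I is invertible and tr((D + δ·I)^{-1}) = tr(D^{-1}) + ε. -/
open Matrix
open scoped ComplexOrder

/-- The operator norm of a complex `N × N` matrix, with respect to the Euclidean norm on
`ℂ^N`. -/
noncomputable def opNorm {N : ℕ} (M : Matrix (Fin N) (Fin N) ℂ) : ℝ :=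
  ‖Matrix.toEuclideanCLM (𝕜 := ℂ) M‖

open Unitary in
/-- A nonsingular real shift `A + c` of a Hermitian matrix `A` is invertible, and the trace of its
inverse is the sum of the inverses of the shifted eigenvalues. -/
lemma Matrix.IsHermitian.isUnit_add_smul_one_and_trace_inv {𝕜 n : Type*} [RCLike 𝕜] [Fintype n]
    [DecidableEq n] {A : Matrix n n 𝕜} (hA : A.IsHermitian) {c : ℝ}
    (hc : ∀ i, hA.eigenvalues i + c ≠ 0) :
    IsUnit (A + (c : 𝕜) • (1 : Matrix n n 𝕜)) ∧
      ((A + (c : 𝕜) • (1 : Matrix n n 𝕜))⁻¹).trace =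
        ((∑ i, (hA.eigenvalues i + c)⁻¹ : ℝ) : 𝕜) := by
  set φ := conjStarAlgAut 𝕜 _ hA.eigenvectorUnitary with hφ
  have hshift : A + (c : 𝕜) • (1 : Matrix n n 𝕜) =
      φ (diagonal fun i ↦ ((hA.eigenvalues i + c : ℝ) : 𝕜)) := by
    conv_lhs => rw [hA.spectral_theorem, ← hφ, ← map_one φ, ← map_smul, ← map_add]
    rw [smul_one_eq_diagonal, diagonal_add]
    simp
  have hmul : (A + (c : 𝕜) • (1 : Matrix n n 𝕜)) *
      φ (diagonal fun i ↦ (((hA.eigenvalues i + c)⁻¹ : ℝ) : 𝕜)) = 1 := by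
    rw [hshift, ← map_mul, diagonal_mul_diagonal]
    simp_rw [← RCLike.ofReal_mul, mul_inv_cancel₀ (hc _), RCLike.ofReal_one]
    rw [diagonal_one, map_one]
  refine ⟨IsUnit.of_mul_eq_one _ hmul, ?_⟩
  rw [inv_eq_right_inv hmul, hφ, conjStarAlgAut_apply, trace_mul_comm, ← mul_assoc]
  simp [trace_diagonal]

/-- The eigenvalues of `A` lie within the operator norm of `A - 1` of `1`. -/
lemma Matrix.IsHermitian.abs_eigenvalues_sub_one_le_opNorm {N : ℕ} {A : Matrix (Fin N) (Fin N) ℂ}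
    (hA : A.IsHermitian) (i : Fin N) :
    |hA.eigenvalues i - 1| ≤ opNorm (A - 1) := by
  have hv : Matrix.toEuclideanCLM (𝕜 := ℂ) (A - 1) (hA.eigenvectorBasis i) =
      ((hA.eigenvalues i - 1 : ℝ) : ℂ) • hA.eigenvectorBasis i := by
    apply WithLp.ofLp_injective
    rw [ofLp_toEuclideanCLM, sub_mulVec, one_mulVec, hA.mulVec_eigenvectorBasis]
    ext j
    simp [sub_mul]
  have h := (Matrix.toEuclideanCLM (𝕜 := ℂ) (A - 1)).le_opNorm (hA.eigenvectorBasis i)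
  rw [hv, norm_smul, hA.eigenvectorBasis.orthonormal.1 i, mul_one, mul_one,
    Complex.norm_real, Real.norm_eq_abs] at h
  exact h

/-- Decreasing `x` by `t` increases `x⁻¹` by at least `t / 4`, as long as `x * (x - t) ≤ 4`. -/
lemma inv_add_div_four_le_inv_sub {x t : ℝ} (ht : 0 ≤ t) (hxt : t < x) (h : x * (x - t) ≤ 4) :
    x⁻¹ + t / 4 ≤ (x - t)⁻¹ := by
  have hy : 0 < x - t := sub_pos.2 hxt
  have hx : 0 < x := ht.trans_lt hxt
  have hdiff : (x - t)⁻¹ - x⁻¹ = t / (x * (x - t)) := by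
    field_simp
    ring
  have : t / 4 ≤ t / (x * (x - t)) := by gcongr
  linarith

/-- The shift `δ` in `∑ (x i + δ)⁻¹ = ∑ (x i)⁻¹ + ε` can be solved for when all `x i` are within
`1 / 4` of `1`. -/
lemma exists_sum_inv_add_eq {ι : Type*} [Fintype ι] [Nonempty ι] {x : ι → ℝ}
    (hx : ∀ i, |x i - 1| ≤ 1 / 4) {ε : ℝ} (hε : |ε| ≤ (Fintype.card ι : ℝ) / 9) :
    ∃ δ : ℝ, |δ| ≤ 4 * |ε| / (Fintype.card ι : ℝ) ∧ (∀ i, 0 < x i + δ) ∧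
      ∑ i, (x i + δ)⁻¹ = ∑ i, (x i)⁻¹ + ε := by
  have hcard : (0 : ℝ) < Fintype.card ι := by exact_mod_cast Fintype.card_pos
  set t : ℝ := 4 * |ε| / (Fintype.card ι : ℝ) with ht
  have ht0 : 0 ≤ t := by positivity
  have ht1 : t ≤ 4 / 9 := by
    rw [ht, div_le_iff₀ hcard]
    linarith
  have hsum : ∑ _i : ι, t / 4 = |ε| := by
    rw [Finset.sum_const, Finset.card_univ, nsmul_eq_mul, ht]
    field_simp
  have hlo (i : ι) : 3 / 4 ≤ x i := by linarith [(abs_le.1 (hx i)).1]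
  have hhi (i : ι) : x i ≤ 5 / 4 := by linarith [(abs_le.1 (hx i)).2]
  have hpos {δ : ℝ} (hδ : δ ∈ Set.Icc (-t) t) (i : ι) : 0 < x i + δ := by
    linarith [hδ.1, hlo i]
  have hcont : ContinuousOn (fun δ ↦ ∑ i, (x i + δ)⁻¹) (Set.Icc (-t) t) :=
    continuousOn_finsetSum _ fun i _ ↦
      (continuousOn_const.add continuousOn_id).inv₀ fun δ hδ ↦ (hpos hδ i).ne'
  have hleft : ∑ i, (x i)⁻¹ + ε ≤ ∑ i, (x i + -t)⁻¹ := by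
    calc ∑ i, (x i)⁻¹ + ε ≤ ∑ i, (x i)⁻¹ + ∑ _i : ι, t / 4 := by
          rw [hsum]
          gcongr
          exact le_abs_self ε
      _ = ∑ i, ((x i)⁻¹ + t / 4) := Finset.sum_add_distrib.symm
      _ ≤ ∑ i, (x i + -t)⁻¹ := Finset.sum_le_sum fun i _ ↦ by
          rw [← sub_eq_add_neg]
          refine inv_add_div_four_le_inv_sub ht0 (by linarith [hlo i]) ?_
          nlinarith [hlo i, hhi i]
  have hright : ∑ i, (x i + t)⁻¹ ≤ ∑ i, (x i)⁻¹ + ε := by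
    have h : ∑ i, ((x i + t)⁻¹ + t / 4) ≤ ∑ i, (x i)⁻¹ := Finset.sum_le_sum fun i _ ↦ by
      have := inv_add_div_four_le_inv_sub (x := x i + t) ht0 (by linarith [hlo i])
        (by nlinarith [hlo i, hhi i])
      rwa [add_sub_cancel_right] at this
    rw [Finset.sum_add_distrib, hsum] at h
    linarith [neg_abs_le ε]
  obtain ⟨δ, hδ, hδε⟩ := intermediate_value_Icc' (by linarith) hcont ⟨hright, hleft⟩
  exact ⟨δ, abs_le.2 hδ, hpos hδ, hδε⟩

/-- For Hermitian positive-definite `D` with `‖D − I‖_op ≤ 1/4` and any real `ε`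
with `|ε| ≤ N/9`, there is `δ` with `|δ| ≤ 4|ε|/N` such that `D + δ·I` is invertible and
`tr((D + δ·I)⁻¹) = tr(D⁻¹) + ε`. -/
theorem exists_delta_trace_inverse
    (N : ℕ) (hN : 0 < N) (D : Matrix (Fin N) (Fin N) ℂ) (hD : D.PosDef)
    (hDI : opNorm (D - 1) ≤ 1 / 4)
    (ε : ℝ) (hε : |ε| ≤ (N : ℝ) / 9) :
    ∃ δ : ℝ, |δ| ≤ 4 * |ε| / (N : ℝ) ∧
      IsUnit (D + (δ : ℂ) • (1 : Matrix (Fin N) (Fin N) ℂ)) ∧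
      Matrix.trace ((D + (δ : ℂ) • (1 : Matrix (Fin N) (Fin N) ℂ))⁻¹)
        = Matrix.trace D⁻¹ + (ε : ℂ) := by
  have : NeZero N := ⟨hN.ne'⟩
  have hA := hD.isHermitian
  obtain ⟨δ, hδ, hpos, hsum⟩ := exists_sum_inv_add_eq (x := hA.eigenvalues) (ε := ε)
    (fun i ↦ (hA.abs_eigenvalues_sub_one_le_opNorm i).trans hDI) (by simpa using hε)
  obtain ⟨hunit, htrace⟩ := hA.isUnit_add_smul_one_and_trace_inv fun i ↦ (hpos i).ne'
  have hzero := (hA.isUnit_add_smul_one_and_trace_inv (c := 0)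
    fun i ↦ by simpa using (hD.eigenvalues_pos i).ne').2
  simp only [RCLike.ofReal_zero, zero_smul, add_zero] at hzero
  refine ⟨δ, by simpa using hδ, hunit, htrace.trans ?_⟩
  rw [hzero, hsum, RCLike.ofReal_add]
  rfl
end

section
/- Let N be a positive integer, let D be an N×N Hermitian positive-definite complex matrix with ‖D − I‖_op ≤ 1/4, let c be a real number with 1/2 ≤ c ≤ 2, and let E be an N×N Hermitian complex matrix with ‖E‖_F ≤ √N/100. Then there exists δ ∈ ℝ with |δ| ≤ 4‖E‖_F/(c·√N) such that D + δ·I is invertible, the matrix M := c·D^{-1} + E − c·(D + δ·I)^{-1} is Hermitian with tr(M) = 0, and ‖M‖_F ≤ 12·‖E‖_F. -/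
open Matrix
open scoped ComplexOrder

/-- The Frobenius (Hilbert–Schmidt) norm `‖M‖_F = (tr(Mᴴ M))^{1/2}`. -/
noncomputable def frobNorm {N : ℕ} (M : Matrix (Fin N) (Fin N) ℂ) : ℝ :=
  Real.sqrt (Matrix.trace (Mᴴ * M)).re

open Unitary in
lemma trace_conjStarAlgAut {N : ℕ} (U : unitary (Matrix (Fin N) (Fin N) ℂ))
    (X : Matrix (Fin N) (Fin N) ℂ) :
    (conjStarAlgAut ℂ _ U X).trace = X.trace := by
  rw [conjStarAlgAut_apply, Matrix.trace_mul_comm, ← mul_assoc, ← Unitary.coe_star]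
  simp

open Unitary in
lemma frobNorm_conjStarAlgAut {N : ℕ} (U : unitary (Matrix (Fin N) (Fin N) ℂ))
    (X : Matrix (Fin N) (Fin N) ℂ) :
    frobNorm (conjStarAlgAut ℂ _ U X) = frobNorm X := by
  unfold frobNorm
  rw [← Matrix.star_eq_conjTranspose, ← map_star, ← map_mul, trace_conjStarAlgAut,
    Matrix.star_eq_conjTranspose]

lemma re_trace_conjTranspose_mul_self {N : ℕ} (X : Matrix (Fin N) (Fin N) ℂ) :
    (Matrix.trace (Xᴴ * X)).re = ∑ i, ∑ j, ‖X i j‖ ^ 2 := by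
  rw [Finset.sum_comm]
  simp [Matrix.trace, Matrix.mul_apply, ← Complex.normSq_eq_norm_sq, Complex.normSq_apply]

lemma frobNorm_eq_sqrt {N : ℕ} (X : Matrix (Fin N) (Fin N) ℂ) :
    frobNorm X = Real.sqrt (∑ i, ∑ j, ‖X i j‖ ^ 2) := by
  rw [frobNorm, re_trace_conjTranspose_mul_self]

lemma frobNorm_nonneg {N : ℕ} (X : Matrix (Fin N) (Fin N) ℂ) : 0 ≤ frobNorm X :=
  Real.sqrt_nonneg _

lemma frobNorm_add_le {N : ℕ} (X Y : Matrix (Fin N) (Fin N) ℂ) :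
    frobNorm (X + Y) ≤ frobNorm X + frobNorm Y := by
  let := Matrix.frobeniusNormedAddCommGroup (m := Fin N) (n := Fin N) (α := ℂ)
  have h (Z : Matrix (Fin N) (Fin N) ℂ) : frobNorm Z = ‖Z‖ := by
    simp [frobNorm_eq_sqrt, Matrix.frobenius_norm_def, Real.sqrt_eq_rpow]
  simpa only [h] using norm_add_le X Y

lemma frobNorm_diagonal_le {N : ℕ} (v : Fin N → ℂ) {b : ℝ} (hb : 0 ≤ b)
    (hv : ∀ i, ‖v i‖ ≤ b) : frobNorm (Matrix.diagonal v) ≤ b * Real.sqrt N := by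
  have h : ∑ i, ∑ j, ‖Matrix.diagonal v i j‖ ^ 2 ≤ b ^ 2 * N := by
    calc ∑ i, ∑ j, ‖Matrix.diagonal v i j‖ ^ 2 = ∑ i, ‖v i‖ ^ 2 := by
          refine Finset.sum_congr rfl fun i _ => ?_
          rw [Finset.sum_eq_single i] <;> simp +contextual [eq_comm]
      _ ≤ ∑ _i : Fin N, b ^ 2 := Finset.sum_le_sum fun i _ =>
          pow_le_pow_left₀ (norm_nonneg _) (hv i) 2
      _ = b ^ 2 * N := by simp [mul_comm]
  rw [frobNorm_eq_sqrt]
  calc _ ≤ Real.sqrt (b ^ 2 * N) := Real.sqrt_le_sqrt h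
    _ = b * Real.sqrt N := by rw [Real.sqrt_mul (sq_nonneg b), Real.sqrt_sq hb]

lemma norm_trace_le_frobNorm {N : ℕ} (X : Matrix (Fin N) (Fin N) ℂ) :
    ‖X.trace‖ ≤ Real.sqrt N * frobNorm X := by
  rw [frobNorm_eq_sqrt, ← Real.sqrt_mul (Nat.cast_nonneg N)]
  apply Real.le_sqrt_of_sq_le
  calc ‖X.trace‖ ^ 2 ≤ (∑ i, ‖X i i‖) ^ 2 :=
        pow_le_pow_left₀ (norm_nonneg _) (norm_sum_le _ _) 2
    _ ≤ N * ∑ i, ‖X i i‖ ^ 2 := by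
        simpa using sq_sum_le_card_mul_sum_sq (s := Finset.univ) (f := fun i => ‖X i i‖)
    _ ≤ N * ∑ i, ∑ j, ‖X i j‖ ^ 2 := by
        gcongr with i
        exact Finset.single_le_sum (f := fun j => ‖X i j‖ ^ 2) (fun j _ => sq_nonneg _)
          (Finset.mem_univ i)

open Unitary in
lemma Matrix.IsHermitian.add_smul_one_mul {N : ℕ} {A : Matrix (Fin N) (Fin N) ℂ}
    (hA : A.IsHermitian) (δ : ℝ) (h : ∀ i, hA.eigenvalues i + δ ≠ 0) :
    (A + (δ : ℂ) • (1 : Matrix (Fin N) (Fin N) ℂ)) *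
      conjStarAlgAut ℂ _ hA.eigenvectorUnitary
        (Matrix.diagonal fun i => (((hA.eigenvalues i + δ)⁻¹ : ℝ) : ℂ)) = 1 := by
  have h₁ : A + (δ : ℂ) • (1 : Matrix (Fin N) (Fin N) ℂ)
      = conjStarAlgAut ℂ _ hA.eigenvectorUnitary
        (Matrix.diagonal fun i => ((hA.eigenvalues i + δ : ℝ) : ℂ)) := by
    have h₂ : (Matrix.diagonal fun i => ((hA.eigenvalues i + δ : ℝ) : ℂ))
        = Matrix.diagonal (RCLike.ofReal ∘ hA.eigenvalues)
          + (δ : ℂ) • (1 : Matrix (Fin N) (Fin N) ℂ) := by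
      ext i j
      by_cases hij : i = j <;> simp [hij]
    rw [h₂, map_add, map_smul, map_one, ← hA.spectral_theorem]
  rw [h₁, ← map_mul, Matrix.diagonal_mul_diagonal, ← map_one (conjStarAlgAut ℂ _ _),
    ← Matrix.diagonal_one]
  congr 2
  ext i
  rw [← Complex.ofReal_mul, mul_inv_cancel₀ (h i), Complex.ofReal_one]

open Unitary in
lemma Matrix.IsHermitian.smul_inv_sub_smul_inv {N : ℕ} {A : Matrix (Fin N) (Fin N) ℂ}
    (hA : A.IsHermitian) (c δ : ℝ) (h₀ : ∀ i, hA.eigenvalues i ≠ 0)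
    (h : ∀ i, hA.eigenvalues i + δ ≠ 0) :
    (c : ℂ) • A⁻¹ - (c : ℂ) • (A + (δ : ℂ) • (1 : Matrix (Fin N) (Fin N) ℂ))⁻¹ =
      conjStarAlgAut ℂ _ hA.eigenvectorUnitary
        (Matrix.diagonal fun i =>
          ((c * δ / (hA.eigenvalues i * (hA.eigenvalues i + δ)) : ℝ) : ℂ)) := by
  have h₁ := hA.add_smul_one_mul 0 (by simpa using h₀)
  simp only [Complex.ofReal_zero, zero_smul, add_zero] at h₁
  rw [Matrix.inv_eq_right_inv h₁, Matrix.inv_eq_right_inv (hA.add_smul_one_mul δ h),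
    ← map_smul, ← map_smul, ← map_sub]
  congr 1
  ext i j
  by_cases hij : i = j
  · subst hij
    simp only [Matrix.sub_apply, Matrix.smul_apply, Matrix.diagonal_apply_eq, smul_eq_mul]
    norm_cast
    have := h₀ i
    have := h i
    field_simp
    ring
  · simp [hij]

lemma exists_add_sum_div_eq_zero {N : ℕ} {l : Fin N → ℝ} {c d t : ℝ} (hc : 0 ≤ c) (hd : 0 ≤ d)
    (hd' : d ≤ 2 / 25) (hl : ∀ i, 3 / 4 ≤ l i ∧ l i ≤ 5 / 4) (ht : |t| ≤ N * (c * d / 4)) :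
    ∃ δ : ℝ, |δ| ≤ d ∧ t + ∑ i, c * δ / (l i * (l i + δ)) = 0 := by
  have hcd : 0 ≤ c * d := mul_nonneg hc hd
  have hlow : t + ∑ i, c * (-d) / (l i * (l i + -d)) ≤ 0 := by
    have : ∑ i, c * (-d) / (l i * (l i + -d)) ≤ ∑ _i : Fin N, -(c * d / 4) := by
      refine Finset.sum_le_sum fun i _ => ?_
      obtain ⟨h1, h2⟩ := hl i
      rw [mul_neg, neg_div, neg_le_neg_iff]
      gcongr
      · nlinarith
      · nlinarith
    simp only [Finset.sum_const, Finset.card_univ, Fintype.card_fin, nsmul_eq_mul] at this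
    linarith [(abs_le.1 ht).2]
  have hhigh : 0 ≤ t + ∑ i, c * d / (l i * (l i + d)) := by
    have : ∑ _i : Fin N, c * d / 4 ≤ ∑ i, c * d / (l i * (l i + d)) := by
      refine Finset.sum_le_sum fun i _ => ?_
      obtain ⟨h1, h2⟩ := hl i
      gcongr
      nlinarith
    simp only [Finset.sum_const, Finset.card_univ, Fintype.card_fin, nsmul_eq_mul] at this
    linarith [(abs_le.1 ht).1]
  have hcont : ContinuousOn (fun δ : ℝ => t + ∑ i, c * δ / (l i * (l i + δ)))
      (Set.Icc (-d) d) := by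
    refine continuousOn_const.add (continuousOn_finsetSum _ fun i _ => ?_)
    refine ContinuousOn.div (by fun_prop) (by fun_prop) fun δ hδ => ?_
    have h1 := (hl i).1
    have h2 := hδ.1
    have : 0 < l i + δ := by linarith
    positivity
  obtain ⟨δ, hδ, h0⟩ := intermediate_value_Icc (by linarith) hcont ⟨hlow, hhigh⟩
  exact ⟨δ, abs_le.2 hδ, h0⟩

/-- Perturbing the constant makes the error term trace-free while keeping
its Frobenius norm comparable. -/
theorem exists_delta_trace_free_error
    (N : ℕ) (hN : 0 < N) (D : Matrix (Fin N) (Fin N) ℂ) (hD : D.PosDef)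
    (hDI : opNorm (D - 1) ≤ 1 / 4)
    (c : ℝ) (hc1 : 1 / 2 ≤ c) (hc2 : c ≤ 2)
    (E : Matrix (Fin N) (Fin N) ℂ) (hE : E.IsHermitian)
    (hEF : frobNorm E ≤ Real.sqrt (N : ℝ) / 100) :
    ∃ δ : ℝ, |δ| ≤ 4 * frobNorm E / (c * Real.sqrt (N : ℝ)) ∧
      IsUnit (D + (δ : ℂ) • (1 : Matrix (Fin N) (Fin N) ℂ)) ∧
      ((c : ℂ) • D⁻¹ + E - (c : ℂ) • (D + (δ : ℂ) • (1 : Matrix (Fin N) (Fin N) ℂ))⁻¹).IsHermitian ∧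
      Matrix.trace ((c : ℂ) • D⁻¹ + E
        - (c : ℂ) • (D + (δ : ℂ) • (1 : Matrix (Fin N) (Fin N) ℂ))⁻¹) = 0 ∧
      frobNorm ((c : ℂ) • D⁻¹ + E
        - (c : ℂ) • (D + (δ : ℂ) • (1 : Matrix (Fin N) (Fin N) ℂ))⁻¹) ≤ 12 * frobNorm E := by
  set e := frobNorm E
  have he0 : 0 ≤ e := frobNorm_nonneg E
  have hr : 0 < Real.sqrt (N : ℝ) := Real.sqrt_pos.2 (by exact_mod_cast hN)
  have hrr : Real.sqrt (N : ℝ) * Real.sqrt (N : ℝ) = N := Real.mul_self_sqrt (Nat.cast_nonneg N)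
  have hc : 0 < c := by linarith
  set d := 4 * e / (c * Real.sqrt (N : ℝ)) with hd
  have hd0 : 0 ≤ d := by positivity
  have hcd : c * d * Real.sqrt (N : ℝ) = 4 * e := by
    rw [hd]
    field_simp
  have hd1 : d ≤ 2 / 25 := by
    rw [hd, div_le_iff₀ (by positivity)]
    nlinarith
  have hl (i : Fin N) : 3 / 4 ≤ hD.1.eigenvalues i ∧ hD.1.eigenvalues i ≤ 5 / 4 := by
    have h := abs_le.1 ((hD.1.abs_eigenvalues_sub_one_le_opNorm i).trans hDI)
    constructor <;> linarith
  have hEtr : ((E.trace.re : ℝ) : ℂ) = E.trace := by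
    apply Complex.conj_eq_iff_re.1
    rw [starRingEnd_apply, ← Matrix.trace_conjTranspose, hE.eq]
  have ht : |E.trace.re| ≤ N * (c * d / 4) := by
    calc |E.trace.re| ≤ Real.sqrt N * e :=
          (Complex.abs_re_le_norm _).trans (norm_trace_le_frobNorm E)
      _ = N * (c * d / 4) := by
          linear_combination -(Real.sqrt N / 4) * hcd + c * d / 4 * hrr
  obtain ⟨δ, hδ, h0⟩ := exists_add_sum_div_eq_zero hc.le hd0 hd1 hl ht
  have hδ' := abs_le.1 hδ
  have hl0 (i : Fin N) : hD.1.eigenvalues i ≠ 0 := by linarith [(hl i).1]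
  have hlδ (i : Fin N) : hD.1.eigenvalues i + δ ≠ 0 := by linarith [(hl i).1]
  have hdiff := hD.1.smul_inv_sub_smul_inv c δ hl0 hlδ
  have hsplit (X Y : Matrix (Fin N) (Fin N) ℂ) : X + E - Y = E + (X - Y) := by abel
  refine ⟨δ, hδ, IsUnit.of_mul_eq_one _ (hD.1.add_smul_one_mul δ hlδ), ?_, ?_, ?_⟩
  · have hsmul (x : ℝ) {X : Matrix (Fin N) (Fin N) ℂ} (hX : X.IsHermitian) :
        ((x : ℂ) • X).IsHermitian := by
      rw [Matrix.IsHermitian, Matrix.conjTranspose_smul, hX.eq, Complex.star_def,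
        Complex.conj_ofReal]
    exact ((hsmul c hD.1.inv).add hE).sub
      (hsmul c (hD.1.add (hsmul δ Matrix.isHermitian_one)).inv)
  · rw [hsplit, hdiff, Matrix.trace_add, trace_conjStarAlgAut, Matrix.trace_diagonal, ← hEtr]
    exact_mod_cast h0
  · rw [hsplit, hdiff]
    refine (frobNorm_add_le _ _).trans ?_
    rw [frobNorm_conjStarAlgAut]
    have hdiag := frobNorm_diagonal_le (b := c * d * 2)
      (fun i => ((c * δ / (hD.1.eigenvalues i * (hD.1.eigenvalues i + δ)) : ℝ) : ℂ))
      (by positivity) fun i => by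
        have h1 := (hl i).1
        have hpos : 1 / 2 ≤ hD.1.eigenvalues i * (hD.1.eigenvalues i + δ) := by nlinarith
        rw [Complex.norm_real, Real.norm_eq_abs, abs_div, abs_mul, abs_of_pos hc,
          abs_of_pos (show 0 < hD.1.eigenvalues i * (hD.1.eigenvalues i + δ) by linarith),
          div_le_iff₀ (by linarith)]
        nlinarith [mul_le_mul_of_nonneg_left hδ hc.le, mul_nonneg hc.le hd0]
    nlinarith
end
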